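/- Under assumptions (A1)–(A4): for every bounded Lipschitz function φ : (0,1) → ℝ, the family (Uⁿφ)_{n≥0} is equicontinuous at every point of [1−x₀, x₀]; that is, for every x ∈ [1−x₀, x₀] and every δ > 0 there exists d > 0 such that |Uⁿφ(x) − Uⁿφ(y)| < δ for every n ≥ 0 and every y ∈ (0,1) with |x − y| < d. -/

import Mathlib

/-
Formalization of the Alsedà–Misiurewicz system setup:
`f0, f1` are the piecewise-linear interval homeomorphisms, `iter` the random
iteration along ω ∈ Σ = {0,1}^ℕ, `IsKernel` characterises the family x ↦ ℙ_x by
its values on cylinder sets, `Pop` is the Markov operator (as a set function),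
`Stationary` expresses P-invariance for probability measures on (0,1), `U` is
the dual operator, and `A1`–`A4` are the assumptions of the paper.
-/

open MeasureTheory Filter Set
open scoped ENNReal Topology

namespace AM

noncomputable def f0 (x₀ y₀ : ℝ) (x : ℝ) : ℝ :=
  if x ≤ x₀ then (y₀ / x₀) * x else ((1 - y₀) / (1 - x₀)) * (x - 1) + 1

noncomputable def f1 (x₀ y₀ : ℝ) (x : ℝ) : ℝ := 1 - f0 x₀ y₀ (1 - x)

/-- `fb b` is `f₁` if `b = true`, and `f₀` if `b = false`. -/
noncomputable def fb (x₀ y₀ : ℝ) (b : Bool) : ℝ → ℝ :=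
  if b then f1 x₀ y₀ else f0 x₀ y₀

/-- `iter x₀ y₀ ω n x = f^n_ω(x) = f_{ω (n-1)} ∘ ⋯ ∘ f_{ω 0} (x)`, with `f^0_ω = id`. -/
noncomputable def iter (x₀ y₀ : ℝ) (ω : ℕ → Bool) : ℕ → ℝ → ℝ
  | 0, x => x
  | n + 1, x => fb x₀ y₀ (ω n) (iter x₀ y₀ ω n x)

/-- `cylProb x₀ y₀ p₀ p₁ x w = p_{i₁}(x) p_{i₂}(f_{i₁} x) ⋯` for the word `w = (i₁, …, i_k)`. -/
noncomputable def cylProb (x₀ y₀ : ℝ) (p₀ p₁ : ℝ → ℝ) : ℝ → List Bool → ℝ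
  | _, [] => 1
  | x, b :: w => (if b then p₁ x else p₀ x) * cylProb x₀ y₀ p₀ p₁ (fb x₀ y₀ b x) w

/-- The cylinder set of sequences starting with the word `w`. -/
def cyl (w : List Bool) : Set (ℕ → Bool) := {ω | ∀ j : Fin w.length, ω j = w.get j}

/-- `IsKernel x₀ y₀ p₀ p₁ Pm` says that `Pm x = ℙ_x` for all `x ∈ (0,1)`, i.e. `Pm x` gives
every cylinder set its prescribed probability (this determines `Pm x` uniquely and makes it a
probability measure, since the empty word gives `Pm x univ = 1`). -/
def IsKernel (x₀ y₀ : ℝ) (p₀ p₁ : ℝ → ℝ) (Pm : ℝ → Measure (ℕ → Bool)) : Prop :=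
  ∀ x ∈ Ioo (0:ℝ) 1, ∀ w : List Bool,
    Pm x (cyl w) = ENNReal.ofReal (cylProb x₀ y₀ p₀ p₁ x w)

/-- The Markov operator `P`, as a set function:
`Pop μ A = ∫_{f₀⁻¹(A)} p₀ dμ + ∫_{f₁⁻¹(A)} p₁ dμ`. -/
noncomputable def Pop (x₀ y₀ : ℝ) (p₀ p₁ : ℝ → ℝ) (μ : Measure ℝ) (A : Set ℝ) : ℝ≥0∞ :=
  (∫⁻ x in f0 x₀ y₀ ⁻¹' A, ENNReal.ofReal (p₀ x) ∂μ) +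
    ∫⁻ x in f1 x₀ y₀ ⁻¹' A, ENNReal.ofReal (p₁ x) ∂μ

/-- A stationary (P-invariant) Borel probability measure on (0,1). -/
def Stationary (x₀ y₀ : ℝ) (p₀ p₁ : ℝ → ℝ) (μ : Measure ℝ) : Prop :=
  IsProbabilityMeasure μ ∧ μ (Ioo 0 1) = 1 ∧
    ∀ A : Set ℝ, MeasurableSet A → A ⊆ Ioo 0 1 → μ A = Pop x₀ y₀ p₀ p₁ μ A

/-- The dual operator `Uφ(x) = p₀(x) φ(f₀ x) + p₁(x) φ(f₁ x)`. -/
noncomputable def U (x₀ y₀ : ℝ) (p₀ p₁ : ℝ → ℝ) (φ : ℝ → ℝ) : ℝ → ℝ :=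
  fun x => p₀ x * φ (f0 x₀ y₀ x) + p₁ x * φ (f1 x₀ y₀ x)

/-- Assumption (A1): `1/2 < x₀ < 1` and `1/2 ≤ y₀ < x₀`. -/
def A1 (x₀ y₀ : ℝ) : Prop := 1/2 < x₀ ∧ x₀ < 1 ∧ 1/2 ≤ y₀ ∧ y₀ < x₀

/-- Assumption (A2): Dini continuity of `p₀, p₁`; `β` is a modulus of continuity for both, with
`∑ₙ β(C tⁿ) < ∞` for all `C ≥ 0`, `0 < t < 1`. (Such a `β` exists iff the least modulus of
continuity has this summability property.) -/
def A2 (p₀ p₁ : ℝ → ℝ) : Prop :=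
  ∃ β : ℝ → ℝ,
    (∀ t : ℝ, ∀ x ∈ Icc (0:ℝ) 1, ∀ y ∈ Icc (0:ℝ) 1, |x - y| ≤ t →
      |p₀ x - p₀ y| ≤ β t ∧ |p₁ x - p₁ y| ≤ β t) ∧
    (∀ C : ℝ, 0 ≤ C → ∀ t : ℝ, 0 < t → t < 1 → Summable fun n : ℕ => β (C * t ^ n))

/-- Assumption (A3): `p₀, p₁` are continuous, `p₀ + p₁ = 1`, and `0 < pᵢ < 1` on `[0,1]`. -/
def A3 (p₀ p₁ : ℝ → ℝ) : Prop :=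
  ContinuousOn p₀ (Icc 0 1) ∧ ContinuousOn p₁ (Icc 0 1) ∧
    ∀ x ∈ Icc (0:ℝ) 1, p₀ x + p₁ x = 1 ∧ 0 < p₀ x ∧ p₀ x < 1 ∧ 0 < p₁ x ∧ p₁ x < 1

/-- Assumption (A4): the average Lyapunov exponents at 0 and 1 are positive
(`a₀ = y₀/x₀`, `a₁ = (1-y₀)/(1-x₀)`). -/
def A4 (x₀ y₀ : ℝ) (p₀ p₁ : ℝ → ℝ) : Prop :=
  0 < p₀ 0 * Real.log (y₀ / x₀) + p₁ 0 * Real.log ((1 - y₀) / (1 - x₀)) ∧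
    0 < p₀ 1 * Real.log ((1 - y₀) / (1 - x₀)) + p₁ 1 * Real.log (y₀ / x₀)

end AM

namespace AM

variable {x₀ y₀ : ℝ}

theorem A1.slope₀_pos (h : A1 x₀ y₀) : 0 < y₀ / x₀ := by
  obtain ⟨h1, h2, h3, h4⟩ := h
  exact div_pos (by linarith) (by linarith)

theorem A1.slope₀_lt_one (h : A1 x₀ y₀) : y₀ / x₀ < 1 := by
  obtain ⟨h1, h2, h3, h4⟩ := h
  exact (div_lt_one (by linarith)).2 h4

theorem A1.one_lt_slope₁ (h : A1 x₀ y₀) : 1 < (1 - y₀) / (1 - x₀) := by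
  obtain ⟨h1, h2, h3, h4⟩ := h
  exact (one_lt_div (by linarith)).2 (by linarith)

theorem A1.slope₀_mul (h : A1 x₀ y₀) : y₀ / x₀ * x₀ = y₀ :=
  div_mul_cancel₀ _ (by have := h.1; linarith)

theorem A1.slope₁_mul (h : A1 x₀ y₀) : (1 - y₀) / (1 - x₀) * (1 - x₀) = 1 - y₀ :=
  div_mul_cancel₀ _ (by have := h.2.1; linarith)

theorem f0_of_le {x : ℝ} (hx : x ≤ x₀) : f0 x₀ y₀ x = y₀ / x₀ * x := if_pos hx

theorem f0_of_ge (h : A1 x₀ y₀) {x : ℝ} (hx : x₀ ≤ x) :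
    f0 x₀ y₀ x = 1 - (1 - y₀) / (1 - x₀) * (1 - x) := by
  rcases hx.eq_or_lt with rfl | hx
  · rw [f0_of_le le_rfl, h.slope₀_mul, h.slope₁_mul]; ring
  · rw [f0, if_neg hx.not_ge]; ring

theorem f1_of_le (h : A1 x₀ y₀) {x : ℝ} (hx : x ≤ 1 - x₀) :
    f1 x₀ y₀ x = (1 - y₀) / (1 - x₀) * x := by
  rw [f1, f0_of_ge h (by linarith)]; ring

theorem f1_of_ge {x : ℝ} (hx : 1 - x₀ ≤ x) :
    f1 x₀ y₀ x = 1 - y₀ / x₀ * (1 - x) := by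
  rw [f1, f0_of_le (by linarith)]

theorem f0_one_sub (x : ℝ) : f0 x₀ y₀ (1 - x) = 1 - f1 x₀ y₀ x := by
  rw [f1]; ring

theorem f1_one_sub (x : ℝ) : f1 x₀ y₀ (1 - x) = 1 - f0 x₀ y₀ x := by
  rw [f1]; ring_nf

theorem one_sub_mem {x : ℝ} (hx : x ∈ Ioo (0 : ℝ) 1) : 1 - x ∈ Ioo (0 : ℝ) 1 :=
  ⟨by linarith [hx.2], by linarith [hx.1]⟩

theorem f0_strictMono (h : A1 x₀ y₀) : StrictMono (f0 x₀ y₀) := by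
  intro x y hxy
  have ha := h.slope₀_pos
  have hb := h.one_lt_slope₁
  have h0 := h.slope₀_mul
  have h1 := h.slope₁_mul
  rcases le_total y x₀ with hy | hy
  · rw [f0_of_le hy, f0_of_le (hxy.le.trans hy)]
    exact mul_lt_mul_of_pos_left hxy ha
  · rw [f0_of_ge h hy]
    rcases lt_or_ge x x₀ with hx | hx
    · rw [f0_of_le hx.le]; nlinarith
    · rw [f0_of_ge h hx]; nlinarith

theorem f0_mem (h : A1 x₀ y₀) {x : ℝ} (hx : x ∈ Ioo (0 : ℝ) 1) :
    f0 x₀ y₀ x ∈ Ioo (0 : ℝ) 1 := by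
  have e0 : f0 x₀ y₀ 0 = 0 := by rw [f0_of_le (by linarith [h.1])]; ring
  have e1 : f0 x₀ y₀ 1 = 1 := by rw [f0_of_ge h h.2.1.le]; ring
  exact ⟨by simpa [e0] using f0_strictMono h hx.1, by simpa [e1] using f0_strictMono h hx.2⟩

theorem f1_mem (h : A1 x₀ y₀) {x : ℝ} (hx : x ∈ Ioo (0 : ℝ) 1) :
    f1 x₀ y₀ x ∈ Ioo (0 : ℝ) 1 :=
  one_sub_mem (f0_mem h (one_sub_mem hx))

theorem f1_strictMono (h : A1 x₀ y₀) : StrictMono (f1 x₀ y₀) := fun x y hxy => by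
  have := f0_strictMono h (show 1 - y < 1 - x by linarith)
  simp only [f1]; linarith

theorem slope₀_mul_le_f0 (h : A1 x₀ y₀) (x : ℝ) : y₀ / x₀ * x ≤ f0 x₀ y₀ x := by
  rcases le_total x x₀ with hx | hx
  · rw [f0_of_le hx]
  · rw [f0_of_ge h hx]
    nlinarith [h.slope₀_mul, h.slope₁_mul, h.slope₀_lt_one, h.one_lt_slope₁]

theorem slope₀_mul_le_f1 (h : A1 x₀ y₀) {x : ℝ} (hx : x ∈ Ioo (0 : ℝ) 1) :
    y₀ / x₀ * x ≤ f1 x₀ y₀ x := by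
  have h0 := h.slope₀_lt_one
  have h1 := h.one_lt_slope₁
  rcases le_total x (1 - x₀) with hx' | hx'
  · rw [f1_of_le h hx']; nlinarith [hx.1]
  · rw [f1_of_ge hx']; nlinarith [hx.1, hx.2]

/-- The logarithmic coordinate on `(0,1)`, for which both maps are non-expanding. -/
noncomputable def logCoord (x : ℝ) : ℝ :=
  if x ≤ 1 / 2 then Real.log (2 * x) else -Real.log (2 * (1 - x))

theorem logCoord_of_le {x : ℝ} (hx : x ≤ 1 / 2) : logCoord x = Real.log (2 * x) := if_pos hx

theorem logCoord_of_ge {x : ℝ} (hx : 1 / 2 ≤ x) : logCoord x = -Real.log (2 * (1 - x)) := by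
  rcases hx.eq_or_lt with rfl | hx
  · rw [logCoord_of_le le_rfl]; norm_num
  · exact if_neg hx.not_ge

theorem logCoord_one_sub (x : ℝ) : logCoord (1 - x) = -logCoord x := by
  rcases le_total x (1 / 2) with hx | hx
  · rw [logCoord_of_le hx, logCoord_of_ge (by linarith)]; ring_nf
  · rw [logCoord_of_ge hx, logCoord_of_le (by linarith)]; ring_nf

/-- A function which is odd about `1/2` and satisfies an additive two-point inequality on the
left half satisfies it everywhere. -/
theorem two_point_of_half {F H : ℝ → ℝ} {κ : ℝ}
    (hF : ∀ x, F (1 - x) = -F x) (hH : ∀ x, H (1 - x) = -H x)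
    (hle : ∀ x y, κ ≤ x → x ≤ y → y ≤ 1 / 2 → F y - F x ≤ H y - H x)
    {x y : ℝ} (hx : κ ≤ x) (hxy : x ≤ y) (hy : y ≤ 1 - κ) : F y - F x ≤ H y - H x := by
  have hr : ∀ x y, 1 / 2 ≤ x → x ≤ y → y ≤ 1 - κ → F y - F x ≤ H y - H x := by
    intro x y h1 h2 h3
    have := hle (1 - y) (1 - x) (by linarith) (by linarith) (by linarith)
    rw [hF, hF, hH, hH] at this
    linarith
  rcases le_total y (1 / 2) with h1 | h1
  · exact hle x y hx hxy h1
  rcases le_total x (1 / 2) with h2 | h2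
  · linarith [hle x _ hx h2 le_rfl, hr _ y le_rfl h1 hy]
  · exact hr x y h2 hxy hy

theorem sub_le_logCoord_sub {x y : ℝ} (hx : 0 < x) (hxy : x ≤ y) (hy : y < 1) :
    y - x ≤ logCoord y - logCoord x := by
  have := two_point_of_half (F := fun x => x - 1 / 2) (H := logCoord) (κ := min (min x (1 - y)) (1/2))
    (fun x => by ring) logCoord_one_sub ?_
    ((min_le_left _ _).trans (min_le_left _ _)) hxy
    (by linarith [(min_le_left (min x (1 - y)) (1/2)).trans (min_le_right _ _)])
  · linarith
  intro u v hu huv hv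
  have hu0 : 0 < u := lt_of_lt_of_le (by simp [hx, hy]) hu
  rw [logCoord_of_le hv, logCoord_of_le (by linarith), ← Real.log_div (by linarith) (by linarith)]
  have := Real.one_sub_inv_le_log_of_pos (show 0 < 2 * v / (2 * u) by
    apply div_pos <;> linarith)
  have h2 : 1 - (2 * v / (2 * u))⁻¹ = (v - u) / v := by
    have : 0 < v := by linarith
    field_simp
  have h3 : v - u ≤ (v - u) / v := by
    rw [le_div_iff₀ (by linarith)]; nlinarith
  linarith

theorem logCoord_sub_le {κ x y : ℝ} (hκ : 0 < κ) (hx : κ ≤ x) (hxy : x ≤ y)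
    (hy : y ≤ 1 - κ) : logCoord y - logCoord x ≤ (y - x) / κ := by
  have := two_point_of_half (F := logCoord) (H := fun x => (x - 1 / 2) / κ) (κ := κ)
    logCoord_one_sub (fun x => by ring) ?_ hx hxy hy
  · calc _ ≤ _ := this
      _ = _ := by ring
  intro u v hu huv hv
  have hu0 : 0 < u := hκ.trans_le hu
  rw [logCoord_of_le hv, logCoord_of_le (by linarith), ← Real.log_div (by linarith) (by linarith)]
  have := Real.log_le_sub_one_of_pos (show 0 < 2 * v / (2 * u) by
    apply div_pos <;> linarith)
  have h2 : 2 * v / (2 * u) - 1 = (v - u) / u := by field_simp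
  have h3 : (v - u) / u ≤ (v - u) / κ := div_le_div_of_nonneg_left (by linarith) hκ hu
  have h4 : (v - 1 / 2) / κ - (u - 1 / 2) / κ = (v - u) / κ := by ring
  simp only [h4]
  linarith

theorem logCoord_le {x y : ℝ} (hx : 0 < x) (hxy : x ≤ y) (hy : y < 1) :
    logCoord x ≤ logCoord y := by
  linarith [sub_le_logCoord_sub hx hxy hy]

theorem logCoord_lt {x y : ℝ} (hx : 0 < x) (hxy : x < y) (hy : y < 1) :
    logCoord x < logCoord y := by
  linarith [sub_le_logCoord_sub hx hxy.le hy]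

theorem logCoord_f0_sub_le (h : A1 x₀ y₀) {x y : ℝ} (hx : 0 < x) (hxy : x ≤ y) (hy : y < 1) :
    logCoord (f0 x₀ y₀ y) - logCoord (f0 x₀ y₀ x) ≤ logCoord y - logCoord x := by
  have ha := h.slope₀_pos
  have ha1 := h.slope₀_lt_one
  have hb := h.one_lt_slope₁
  have h0 := h.slope₀_mul
  have h1 := h.slope₁_mul
  have e0 : ∀ u ≤ x₀, f0 x₀ y₀ u = y₀ / x₀ * u := fun u => f0_of_le
  have e1 : ∀ u, x₀ ≤ u → f0 x₀ y₀ u = 1 - (1 - y₀) / (1 - x₀) * (1 - u) := fun u => f0_of_ge h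
  obtain ⟨hx1, hx2, hy1, hy2⟩ := h
  generalize y₀ / x₀ = a at *
  generalize (1 - y₀) / (1 - x₀) = b at *
  obtain ⟨k, hak⟩ : ∃ k, a * k = 1 / 2 := ⟨1 / 2 / a, by field_simp⟩
  have hkx : k ≤ x₀ := by by_contra! hc; nlinarith
  have hk2 : 1 / 2 < k := by by_contra! hc; nlinarith
  let F : ℝ → ℝ := fun x => logCoord x - logCoord (f0 x₀ y₀ x)
  have m1 : MonotoneOn F (Ioc 0 (1 / 2)) := by
    intro u hu v hv huv
    change _ - logCoord (f0 x₀ y₀ u) ≤ _ - logCoord (f0 x₀ y₀ v)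
    rw [e0 u (by linarith [hu.2]), e0 v (by linarith [hv.2]), logCoord_of_le hu.2,
      logCoord_of_le hv.2, logCoord_of_le (by nlinarith [hu.1, hu.2]),
      logCoord_of_le (by nlinarith [hv.1, hv.2]), mul_left_comm, mul_left_comm 2 a,
      Real.log_mul ha.ne' (by linarith [hu.1]), Real.log_mul ha.ne' (by linarith [hv.1])]
    linarith
  have m2 : MonotoneOn F (Icc (1 / 2) k) := by
    intro u hu v hv huv
    have hv1 : v < 1 := by linarith [hv.2]
    change _ - logCoord (f0 x₀ y₀ u) ≤ _ - logCoord (f0 x₀ y₀ v)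
    rw [e0 u (by linarith [hu.2]), e0 v (by linarith [hv.2]), logCoord_of_ge hu.1,
      logCoord_of_ge hv.1, logCoord_of_le (by nlinarith [hu.2]),
      logCoord_of_le (by nlinarith [hv.2])]
    have hau : 0 < a * u := by nlinarith [hu.1]
    have hav : 0 < a * v := by nlinarith [hv.1]
    have : Real.log ((2 * (1 - v)) * (2 * (a * v))) ≤ Real.log ((2 * (1 - u)) * (2 * (a * u))) := by
      apply Real.log_le_log (by apply mul_pos <;> linarith)
      have : v * (1 - v) ≤ u * (1 - u) := by nlinarith [hu.1, hv.1]
      nlinarith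
    rw [Real.log_mul (x := 2 * (1 - v)) (by linarith) (by linarith),
      Real.log_mul (x := 2 * (1 - u)) (by linarith) (by linarith)] at this
    linarith
  have m3 : MonotoneOn F (Icc k x₀) := by
    intro u hu v hv huv
    have hv1 : v < 1 := by linarith [hv.2]
    change _ - logCoord (f0 x₀ y₀ u) ≤ _ - logCoord (f0 x₀ y₀ v)
    rw [e0 u (by linarith [hu.2]), e0 v (by linarith [hv.2]),
      logCoord_of_ge (x := u) (by linarith [hu.1]), logCoord_of_ge (x := v) (by linarith [hv.1]),
      logCoord_of_ge (x := a * u) (by nlinarith [hu.1]),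
      logCoord_of_ge (x := a * v) (by nlinarith [hv.1])]
    have hau : 0 < 1 - a * u := by nlinarith [hu.1]
    have hav : 0 < 1 - a * v := by nlinarith [hv.1]
    have : Real.log ((2 * (1 - v)) * (2 * (1 - a * u))) ≤
        Real.log ((2 * (1 - u)) * (2 * (1 - a * v))) := by
      apply Real.log_le_log (by apply mul_pos <;> linarith)
      nlinarith
    rw [Real.log_mul (x := 2 * (1 - v)) (by linarith) (by linarith),
      Real.log_mul (x := 2 * (1 - u)) (by linarith) (by linarith)] at this
    linarith
  have m4 : MonotoneOn F (Ico x₀ 1) := by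
    intro u hu v hv huv
    have hu0 := hu.1
    have hv0 := hv.1
    change _ - logCoord (f0 x₀ y₀ u) ≤ _ - logCoord (f0 x₀ y₀ v)
    rw [e1 u hu0, e1 v hv0,
      logCoord_of_ge (x := u) (by linarith), logCoord_of_ge (x := v) (by linarith),
      logCoord_of_ge (x := 1 - b * (1 - u)) (by nlinarith),
      logCoord_of_ge (x := 1 - b * (1 - v)) (by nlinarith)]
    simp only [sub_sub_cancel]
    rw [mul_left_comm 2 b, mul_left_comm 2 b,
      Real.log_mul (x := b) (by linarith) (by linarith [hu.2]),
      Real.log_mul (x := b) (by linarith) (by linarith [hv.2])]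
    linarith
  have m12 := m1.union_right m2 (isGreatest_Ioc (by norm_num)) (isLeast_Icc hk2.le)
  rw [Ioc_union_Icc_eq_Ioc (by norm_num) hk2.le] at m12
  have m123 := m12.union_right m3 (isGreatest_Ioc (by linarith)) (isLeast_Icc hkx)
  rw [Ioc_union_Icc_eq_Ioc (by linarith) hkx] at m123
  have m := m123.union_right m4 (isGreatest_Ioc (by linarith)) (isLeast_Ico hx2)
  rw [Ioc_union_Ico_eq_Ioo (by linarith) hx2] at m
  have := m ⟨hx, hxy.trans_lt hy⟩ ⟨hx.trans_le hxy, hy⟩ hxy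
  simp only [F] at this
  linarith

theorem logCoord_f1_sub_le (h : A1 x₀ y₀) {x y : ℝ} (hx : 0 < x) (hxy : x ≤ y) (hy : y < 1) :
    logCoord (f1 x₀ y₀ y) - logCoord (f1 x₀ y₀ x) ≤ logCoord y - logCoord x := by
  have := logCoord_f0_sub_le h (x := 1 - y) (y := 1 - x) (by linarith) (by linarith) (by linarith)
  rw [f0_one_sub, f0_one_sub] at this
  simp only [logCoord_one_sub] at this
  linarith

/-- Accumulated loss of logarithmic distance along words of length `n`, each letter being
weighted by `c`. -/
noncomputable def gain (x₀ y₀ c : ℝ) : ℕ → ℝ → ℝ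
  | 0, _ => 0
  | n + 1, x => c * ((logCoord x - logCoord (f0 x₀ y₀ x)) + (logCoord x - logCoord (f1 x₀ y₀ x)) +
      gain x₀ y₀ c n (f0 x₀ y₀ x) + gain x₀ y₀ c n (f1 x₀ y₀ x))

theorem gain_one_sub (c : ℝ) (n : ℕ) (x : ℝ) :
    gain x₀ y₀ c n (1 - x) = -gain x₀ y₀ c n x := by
  induction n generalizing x with
  | zero => simp [gain]
  | succ n ih => simp only [gain, f0_one_sub, f1_one_sub, logCoord_one_sub, ih]; ring

theorem gain_le {c : ℝ} (h : A1 x₀ y₀) (hc : 0 ≤ c) (n : ℕ) {x y : ℝ} (hx : 0 < x) (hxy : x ≤ y)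
    (hy : y < 1) : gain x₀ y₀ c n x ≤ gain x₀ y₀ c n y := by
  induction n generalizing x y with
  | zero => simp [gain]
  | succ n ih =>
    have hx' : x ∈ Ioo (0 : ℝ) 1 := ⟨hx, hxy.trans_lt hy⟩
    have hy' : y ∈ Ioo (0 : ℝ) 1 := ⟨hx.trans_le hxy, hy⟩
    have := ih (f0_mem h hx').1 ((f0_strictMono h).monotone hxy) (f0_mem h hy').2
    have := ih (f1_mem h hx').1 ((f1_strictMono h).monotone hxy) (f1_mem h hy').2
    have := logCoord_f0_sub_le h hx hxy hy
    have := logCoord_f1_sub_le h hx hxy hy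
    exact mul_le_mul_of_nonneg_left (by linarith) hc

theorem gain_succ_sub_ge {c : ℝ} (h : A1 x₀ y₀) (hc : 0 ≤ c) (n : ℕ) {x y : ℝ} (hx : 0 < x)
    (hxy : x ≤ y) (hy : y < 1) :
    c * ((logCoord y - logCoord (f0 x₀ y₀ y)) - (logCoord x - logCoord (f0 x₀ y₀ x))) ≤
      gain x₀ y₀ c (n + 1) y - gain x₀ y₀ c (n + 1) x ∧
    c * ((logCoord y - logCoord (f1 x₀ y₀ y)) - (logCoord x - logCoord (f1 x₀ y₀ x)) +
        (gain x₀ y₀ c n (f1 x₀ y₀ y) - gain x₀ y₀ c n (f1 x₀ y₀ x))) ≤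
      gain x₀ y₀ c (n + 1) y - gain x₀ y₀ c (n + 1) x := by
  have hx' : x ∈ Ioo (0 : ℝ) 1 := ⟨hx, hxy.trans_lt hy⟩
  have hy' : y ∈ Ioo (0 : ℝ) 1 := ⟨hx.trans_le hxy, hy⟩
  have := gain_le h hc n (f0_mem h hx').1 ((f0_strictMono h).monotone hxy) (f0_mem h hy').2
  have := gain_le h hc n (f1_mem h hx').1 ((f1_strictMono h).monotone hxy) (f1_mem h hy').2
  have := logCoord_f0_sub_le h hx hxy hy
  have := logCoord_f1_sub_le h hx hxy hy
  simp only [gain, ← mul_sub]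
  constructor <;> exact mul_le_mul_of_nonneg_left (by linarith) hc

theorem gain_sub_le {c : ℝ} (h : A1 x₀ y₀) (hc : 0 ≤ c) (hc' : c ≤ 1 / 2) (n : ℕ) {x y : ℝ}
    (hx : 0 < x) (hxy : x ≤ y) (hy : y < 1) :
    gain x₀ y₀ c n y - gain x₀ y₀ c n x ≤ logCoord y - logCoord x := by
  induction n generalizing x y with
  | zero => simpa [gain] using logCoord_le hx hxy hy
  | succ n ih =>
    have hx' : x ∈ Ioo (0 : ℝ) 1 := ⟨hx, hxy.trans_lt hy⟩
    have hy' : y ∈ Ioo (0 : ℝ) 1 := ⟨hx.trans_le hxy, hy⟩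
    have h0 := ih (f0_mem h hx').1 ((f0_strictMono h).monotone hxy) (f0_mem h hy').2
    have h1 := ih (f1_mem h hx').1 ((f1_strictMono h).monotone hxy) (f1_mem h hy').2
    have := logCoord_le hx hxy hy
    simp only [gain]
    nlinarith

/-- Logarithmic distance decreased by the accumulated loss. -/
noncomputable def reducedDist (x₀ y₀ c : ℝ) (n : ℕ) (x y : ℝ) : ℝ :=
  |logCoord x - logCoord y| - |gain x₀ y₀ c n x - gain x₀ y₀ c n y|

theorem reducedDist_comm (c : ℝ) (n : ℕ) (x y : ℝ) :
    reducedDist x₀ y₀ c n x y = reducedDist x₀ y₀ c n y x := by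
  rw [reducedDist, reducedDist, abs_sub_comm, abs_sub_comm (gain x₀ y₀ c n x)]

theorem reducedDist_zero (c x y : ℝ) :
    reducedDist x₀ y₀ c 0 x y = |logCoord x - logCoord y| := by
  simp [reducedDist, gain]

theorem reducedDist_of_le {c : ℝ} (h : A1 x₀ y₀) (hc : 0 ≤ c) (n : ℕ) {x y : ℝ} (hx : 0 < x)
    (hxy : x ≤ y) (hy : y < 1) : reducedDist x₀ y₀ c n x y =
      logCoord y - logCoord x - (gain x₀ y₀ c n y - gain x₀ y₀ c n x) := by
  rw [reducedDist, abs_sub_comm, abs_sub_comm (gain x₀ y₀ c n x),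
    abs_of_nonneg (by linarith [logCoord_le hx hxy hy]),
    abs_of_nonneg (by linarith [gain_le h hc n hx hxy hy])]

theorem reducedDist_nonneg {c : ℝ} (h : A1 x₀ y₀) (hc : 0 ≤ c) (hc' : c ≤ 1 / 2) (n : ℕ)
    {x y : ℝ} (hx : x ∈ Ioo (0 : ℝ) 1) (hy : y ∈ Ioo (0 : ℝ) 1) :
    0 ≤ reducedDist x₀ y₀ c n x y := by
  wlog hxy : x ≤ y generalizing x y
  · rw [reducedDist_comm]; exact this hy hx (le_of_not_ge hxy)
  rw [reducedDist_of_le h hc n hx.1 hxy hy.2]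
  linarith [gain_sub_le h hc hc' n hx.1 hxy hy.2]

theorem reducedDist_le (c : ℝ) (n : ℕ) (x y : ℝ) :
    reducedDist x₀ y₀ c n x y ≤ |logCoord x - logCoord y| :=
  sub_le_self _ (abs_nonneg _)

theorem average_reducedDist_le {c q₀ q₁ : ℝ} (h : A1 x₀ y₀) (hc : 0 ≤ c) (h0 : c ≤ q₀)
    (h1 : c ≤ q₁) (hq : q₀ + q₁ = 1) (n : ℕ)
    {x y : ℝ} (hx : x ∈ Ioo (0 : ℝ) 1) (hy : y ∈ Ioo (0 : ℝ) 1) :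
    q₀ * reducedDist x₀ y₀ c n (f0 x₀ y₀ x) (f0 x₀ y₀ y) +
      q₁ * reducedDist x₀ y₀ c n (f1 x₀ y₀ x) (f1 x₀ y₀ y) ≤ reducedDist x₀ y₀ c (n + 1) x y := by
  wlog hxy : x ≤ y generalizing x y
  · simp only [reducedDist_comm _ _ x, reducedDist_comm _ _ (f0 x₀ y₀ x),
      reducedDist_comm _ _ (f1 x₀ y₀ x)]
    exact this hy hx (le_of_not_ge hxy)
  have m0 := (f0_strictMono h).monotone hxy
  have m1 := (f1_strictMono h).monotone hxy
  rw [reducedDist_of_le h hc _ hx.1 hxy hy.2,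
    reducedDist_of_le h hc _ (f0_mem h hx).1 m0 (f0_mem h hy).2,
    reducedDist_of_le h hc _ (f1_mem h hx).1 m1 (f1_mem h hy).2]
  have g0 := gain_le h hc n (f0_mem h hx).1 m0 (f0_mem h hy).2
  have g1 := gain_le h hc n (f1_mem h hx).1 m1 (f1_mem h hy).2
  have l0 := logCoord_f0_sub_le h hx.1 hxy hy.2
  have l1 := logCoord_f1_sub_le h hx.1 hxy hy.2
  obtain rfl : q₁ = 1 - q₀ := by linarith
  simp only [gain]
  have t0 := mul_nonneg (sub_nonneg.2 h0) (add_nonneg (sub_nonneg.2 l0) (sub_nonneg.2 g0))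
  have t1 := mul_nonneg (sub_nonneg.2 h1) (add_nonneg (sub_nonneg.2 l1) (sub_nonneg.2 g1))
  linarith

theorem logDist_f0_le (h : A1 x₀ y₀) {x y : ℝ} (hx : x ∈ Ioo (0 : ℝ) 1)
    (hy : y ∈ Ioo (0 : ℝ) 1) :
    |logCoord (f0 x₀ y₀ x) - logCoord (f0 x₀ y₀ y)| ≤ |logCoord x - logCoord y| := by
  wlog hxy : x ≤ y generalizing x y
  · rw [abs_sub_comm, abs_sub_comm (logCoord x)]; exact this hy hx (le_of_not_ge hxy)
  have := logCoord_le (f0_mem h hx).1 ((f0_strictMono h).monotone hxy) (f0_mem h hy).2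
  rw [abs_sub_comm, abs_sub_comm (logCoord x), abs_of_nonneg (by linarith),
    abs_of_nonneg (by linarith [logCoord_le hx.1 hxy hy.2])]
  exact logCoord_f0_sub_le h hx.1 hxy hy.2

theorem logDist_f1_le (h : A1 x₀ y₀) {x y : ℝ} (hx : x ∈ Ioo (0 : ℝ) 1)
    (hy : y ∈ Ioo (0 : ℝ) 1) :
    |logCoord (f1 x₀ y₀ x) - logCoord (f1 x₀ y₀ y)| ≤ |logCoord x - logCoord y| := by
  have := logDist_f0_le h (one_sub_mem hx) (one_sub_mem hy)
  simp only [f0_one_sub, logCoord_one_sub, neg_sub_neg] at this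
  rwa [abs_sub_comm, abs_sub_comm (logCoord x)]

theorem abs_sub_le_logDist {x y : ℝ} (hx : x ∈ Ioo (0 : ℝ) 1) (hy : y ∈ Ioo (0 : ℝ) 1) :
    |x - y| ≤ |logCoord x - logCoord y| := by
  wlog hxy : x ≤ y generalizing x y
  · rw [abs_sub_comm, abs_sub_comm (logCoord x)]; exact this hy hx (le_of_not_ge hxy)
  have := sub_le_logCoord_sub hx.1 hxy hy.2
  rw [abs_sub_comm, abs_sub_comm (logCoord x), abs_of_nonneg (by linarith),
    abs_of_nonneg (by linarith)]
  exact this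

theorem logDist_sub_ge_of_central (h : A1 x₀ y₀) {x y : ℝ}
    (hx : 1 - x₀ ≤ x) (hxy : x ≤ y) (hy : y ≤ 1 / 2) :
    (1 - y₀ / x₀) * (y - x) ≤ (logCoord y - logCoord x) -
      (logCoord (f0 x₀ y₀ (f1 x₀ y₀ y)) - logCoord (f0 x₀ y₀ (f1 x₀ y₀ x))) := by
  have ha := h.slope₀_pos
  have ha1 := h.slope₀_lt_one
  have hax := h.slope₀_mul
  have e0 : ∀ u ≤ x₀, f0 x₀ y₀ u = y₀ / x₀ * u := fun u => f0_of_le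
  rw [f1_of_ge hx, f1_of_ge (hx.trans hxy)]
  obtain ⟨hx1, hx2, hy1, hy2⟩ := h
  generalize y₀ / x₀ = a at *
  have hz : ∀ z ≤ 1 / 2, 1 - a * (1 - z) ≤ x₀ := by
    intro z hz
    have : (1 - x₀) * x₀ ≤ a / 2 * x₀ := by nlinarith [sq_nonneg (2 * x₀ - 1)]
    have := le_of_mul_le_mul_right this (by linarith)
    nlinarith
  have hz2 : ∀ z ≤ 1 / 2, a * (1 - a * (1 - z)) ≤ 1 / 2 := by
    intro z hz
    nlinarith [sq_nonneg (1 - a), sq_nonneg a]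
  have hx0 : 0 < x := by linarith
  have hy0 : 0 < y := by linarith
  have px : 0 < 1 - a * (1 - x) := by nlinarith
  have py : 0 < 1 - a * (1 - y) := by nlinarith
  rw [e0 _ (hz x (by linarith)), e0 _ (hz y hy), logCoord_of_le hy,
    logCoord_of_le (x := x) (by linarith), logCoord_of_le (hz2 x (by linarith)),
    logCoord_of_le (hz2 y hy), Real.log_mul two_ne_zero hx0.ne', Real.log_mul two_ne_zero hy0.ne',
    Real.log_mul two_ne_zero (mul_pos ha px).ne', Real.log_mul two_ne_zero (mul_pos ha py).ne',
    Real.log_mul ha.ne' px.ne', Real.log_mul ha.ne' py.ne']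
  have key := Real.one_sub_inv_le_log_of_pos
    (show 0 < (y * (1 - a * (1 - x))) / (x * (1 - a * (1 - y))) by positivity)
  rw [Real.log_div (by positivity) (by positivity), Real.log_mul hy0.ne' px.ne',
    Real.log_mul hx0.ne' py.ne', inv_div] at key
  have : (1 - a) * (y - x) ≤ 1 - x * (1 - a * (1 - y)) / (y * (1 - a * (1 - x))) := by
    rw [one_sub_div (by positivity), le_div_iff₀ (by positivity)]
    have e : y * (1 - a * (1 - x)) - x * (1 - a * (1 - y)) = (1 - a) * (y - x) * 1 := by ring
    rw [e]
    apply mul_le_mul_of_nonneg_left _ (mul_nonneg (by linarith) (by linarith))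
    nlinarith
  linarith

/-- On the left half of the central interval the word `f₁, f₀` contracts the logarithmic
distance. -/
theorem gain_sub_ge_of_central {c : ℝ} (h : A1 x₀ y₀) (hc : 0 ≤ c) (hc' : c ≤ 1 / 2) (n : ℕ)
    {x y : ℝ} (hx : 1 - x₀ ≤ x) (hxy : x ≤ y) (hy : y ≤ 1 / 2) :
    c ^ 2 * (1 - y₀ / x₀) * (y - x) ≤ gain x₀ y₀ c (n + 2) y - gain x₀ y₀ c (n + 2) x := by
  have hx0 : x ∈ Ioo (0 : ℝ) 1 := ⟨by linarith [h.2.1], by linarith⟩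
  have hy0 : y ∈ Ioo (0 : ℝ) 1 := ⟨by linarith [h.2.1], by linarith⟩
  have s1 := (gain_succ_sub_ge h hc (n + 1) hx0.1 hxy hy0.2).2
  have s2 := (gain_succ_sub_ge h hc n (f1_mem h hx0).1 ((f1_strictMono h).monotone hxy)
    (f1_mem h hy0).2).1
  have s3 := logCoord_f1_sub_le h hx0.1 hxy hy0.2
  have s4 := logCoord_f0_sub_le h (f1_mem h hx0).1 ((f1_strictMono h).monotone hxy)
    (f1_mem h hy0).2
  have s5 := logDist_sub_ge_of_central h hx hxy hy
  have e1 := mul_le_mul_of_nonneg_left (mul_le_mul_of_nonneg_right (show c ≤ 1 by linarith)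
    (sub_nonneg.2 s3)) hc
  have e2 := mul_le_mul_of_nonneg_left s2 hc
  have e3 := mul_le_mul_of_nonneg_left s5 (sq_nonneg c)
  linarith

theorem exists_gain_sub_ge {c : ℝ} (h : A1 x₀ y₀) (hc : 0 < c) (hc' : c ≤ 1 / 2) {κ : ℝ}
    (hκ : 0 < κ) : ∃ n : ℕ, ∃ ε : ℝ, 0 < ε ∧ 1 ≤ n ∧ ∀ x y, κ ≤ x → x ≤ y → y ≤ 1 - κ →
      ε * (y - x) ≤ gain x₀ y₀ c n y - gain x₀ y₀ c n x := by
  have hb := h.one_lt_slope₁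
  have key : ∀ k : ℕ, ∃ ε : ℝ, 0 < ε ∧ ∀ x y, 1 - x₀ ≤ ((1 - y₀) / (1 - x₀)) ^ k * x → x ≤ y →
      y ≤ 1 / 2 → ε * (y - x) ≤ gain x₀ y₀ c (k + 2) y - gain x₀ y₀ c (k + 2) x := by
    intro k
    induction k with
    | zero =>
      refine ⟨c ^ 2 * (1 - y₀ / x₀), mul_pos (pow_pos hc 2) (by linarith [h.slope₀_lt_one]), ?_⟩
      intro x y hx hxy hy
      exact gain_sub_ge_of_central h hc.le hc' 0 (by simpa using hx) hxy hy
    | succ k ih =>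
      obtain ⟨ε, hε, H⟩ := ih
      set b := (1 - y₀) / (1 - x₀) with hbdef
      have hm : 0 < c ^ 2 * (1 - y₀ / x₀) :=
        mul_pos (pow_pos hc 2) (by linarith [h.slope₀_lt_one])
      refine ⟨min (c * ε) (c ^ 2 * (1 - y₀ / x₀)), lt_min (mul_pos hc hε) hm, ?_⟩
      have hleft : ∀ x y, 1 - x₀ ≤ b ^ (k + 1) * x → x ≤ y → y ≤ 1 - x₀ →
          min (c * ε) (c ^ 2 * (1 - y₀ / x₀)) * (y - x) ≤
            gain x₀ y₀ c (k + 1 + 2) y - gain x₀ y₀ c (k + 1 + 2) x := by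
        intro x y hx hxy hy
        have hx0 : 0 < x := pos_of_mul_pos_right (lt_of_lt_of_le (by linarith [h.2.1]) hx)
          (by positivity)
        have s1 := (gain_succ_sub_ge h hc.le (k + 2) hx0 hxy (by linarith [h.1])).2
        have s3 := logCoord_f1_sub_le h hx0 hxy (by linarith [h.1])
        have s2 := H (b * x) (b * y) (by rw [← mul_assoc, ← pow_succ]; exact hx)
          (mul_le_mul_of_nonneg_left hxy (by linarith))
          (by nlinarith [h.slope₁_mul, h.2.2.1])
        rw [f1_of_le h hy, f1_of_le h (hxy.trans hy)] at s1 s3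
        have t1 : min (c * ε) (c ^ 2 * (1 - y₀ / x₀)) * (y - x) ≤ c * ε * (y - x) :=
          mul_le_mul_of_nonneg_right (min_le_left _ _) (by linarith)
        have t2 : ε * (y - x) ≤ ε * (b * y - b * x) :=
          mul_le_mul_of_nonneg_left (by nlinarith) hε.le
        have t3 : c * (ε * (y - x)) ≤ c * (logCoord y - logCoord (b * y) -
            (logCoord x - logCoord (b * x)) +
            (gain x₀ y₀ c (k + 2) (b * y) - gain x₀ y₀ c (k + 2) (b * x))) :=
          mul_le_mul_of_nonneg_left (by linarith) hc.le
        rw [mul_assoc] at t1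
        exact t1.trans (t3.trans s1)
      have hright : ∀ x y, 1 - x₀ ≤ x → x ≤ y → y ≤ 1 / 2 →
          min (c * ε) (c ^ 2 * (1 - y₀ / x₀)) * (y - x) ≤
            gain x₀ y₀ c (k + 1 + 2) y - gain x₀ y₀ c (k + 1 + 2) x := fun x y hx hxy hy =>
        (mul_le_mul_of_nonneg_right (min_le_right _ _) (by linarith)).trans
          (gain_sub_ge_of_central h hc.le hc' (k + 1) hx hxy hy)
      intro x y hx hxy hy
      rcases le_total y (1 - x₀) with h1 | h1
      · exact hleft x y hx hxy h1
      rcases le_total x (1 - x₀) with h2 | h2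
      · linarith [hleft x _ hx h2 le_rfl, hright _ y le_rfl h1 hy]
      · exact hright x y h2 hxy hy
  obtain ⟨k, hk⟩ := pow_unbounded_of_one_lt ((1 - x₀) / κ) hb
  obtain ⟨ε, hε, H⟩ := key k
  refine ⟨k + 2, ε, hε, by omega, fun x y hx hxy hy => ?_⟩
  have := two_point_of_half (F := fun x => ε * (x - 1 / 2)) (H := gain x₀ y₀ c (k + 2)) (κ := κ)
    (fun x => by ring) (gain_one_sub c _) ?_ hx hxy hy
  · linarith
  intro u v hu huv hv
  have := H u v ?_ huv hv
  · linarith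
  · have := (div_lt_iff₀ hκ).1 hk
    have : ((1 - y₀) / (1 - x₀)) ^ k * κ ≤ ((1 - y₀) / (1 - x₀)) ^ k * u :=
      mul_le_mul_of_nonneg_left hu (by positivity)
    linarith

theorem eventually_average_exp_lt_one {q₀ q₁ l₀ l₁ : ℝ} (hq : q₀ + q₁ = 1) (h₀ : 0 ≤ q₀)
    (h₁ : 0 ≤ q₁) (hpos : 0 < q₀ * l₀ + q₁ * l₁) :
    ∀ᶠ α in 𝓝[>] (0 : ℝ), q₀ * Real.exp (-(α * l₀)) + q₁ * Real.exp (-(α * l₁)) < 1 := by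
  have lim : ∀ c : ℝ, Tendsto (fun α : ℝ => |α * c|) (𝓝[>] 0) (𝓝 0) := fun c =>
    ((by fun_prop : Continuous fun α : ℝ => |α * c|).tendsto' 0 0 (by simp)).mono_left
      nhdsWithin_le_nhds
  filter_upwards [(lim l₀).eventually_le_const one_pos, (lim l₁).eventually_le_const one_pos,
    (lim (q₀ * l₀ ^ 2 + q₁ * l₁ ^ 2)).eventually_lt_const hpos, self_mem_nhdsWithin]
    with α b0 b1 b2 hα
  have hexp : ∀ t : ℝ, |t| ≤ 1 → Real.exp (-t) ≤ 1 - t + t ^ 2 := by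
    intro t ht
    have := (abs_le.1 (Real.abs_exp_sub_one_sub_id_le (x := -t) (by rwa [abs_neg]))).2
    linarith [neg_sq t]
  have t0 := mul_le_mul_of_nonneg_left (hexp _ b0) h₀
  have t1 := mul_le_mul_of_nonneg_left (hexp _ b1) h₁
  have t2 := mul_lt_mul_of_pos_left ((le_abs_self _).trans_lt b2) (show (0 : ℝ) < α from hα)
  obtain rfl : q₁ = 1 - q₀ := by linarith
  linarith

/-- Near a repelling endpoint a small negative power decreases on average. -/
theorem exists_drift_at_zero (h : A1 x₀ y₀) {p₀ p₁ : ℝ → ℝ} (hp₀ : ContinuousOn p₀ (Icc 0 1))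
    (hp₁ : ContinuousOn p₁ (Icc 0 1))
    (hp : ∀ x ∈ Icc (0 : ℝ) 1, p₀ x + p₁ x = 1 ∧ 0 ≤ p₀ x ∧ 0 ≤ p₁ x) {α : ℝ} (hα : 0 < α)
    (hav : p₀ 0 * (y₀ / x₀) ^ (-α) + p₁ 0 * ((1 - y₀) / (1 - x₀)) ^ (-α) < 1) :
    ∃ r < 1, ∃ b, 0 ≤ b ∧ ∀ x ∈ Ioo (0 : ℝ) 1,
      p₀ x * (f0 x₀ y₀ x) ^ (-α) + p₁ x * (f1 x₀ y₀ x) ^ (-α) ≤ r * x ^ (-α) + b := by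
  have ha := h.slope₀_pos
  have hb := h.one_lt_slope₁
  set a := y₀ / x₀ with hadef
  set d := (1 - y₀) / (1 - x₀) with hddef
  obtain ⟨r, hr, hr1⟩ := exists_between hav
  have hr0 : 0 < r := by
    have := hp 0 (by simp)
    refine lt_of_le_of_lt (add_nonneg (mul_nonneg this.2.1 ?_) (mul_nonneg this.2.2 ?_)) hr <;>
      positivity
  have hcont : ContinuousOn (fun x => p₀ x * a ^ (-α) + p₁ x * d ^ (-α)) (Icc 0 1) :=
    (hp₀.mul continuousOn_const).add (hp₁.mul continuousOn_const)
  have hev := (hcont 0 (by simp)).eventually_lt_const hr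
  obtain ⟨ε, hε, hball⟩ := Metric.mem_nhdsWithin_iff.1 hev
  set κ := min ε (1 - x₀) with hκdef
  have hκ : 0 < κ := lt_min hε (by linarith [h.2.1])
  refine ⟨r, hr1, (a * κ) ^ (-α), by positivity, fun x hx => ?_⟩
  have hp' := hp x ⟨hx.1.le, hx.2.le⟩
  rcases lt_or_ge x κ with hxκ | hxκ
  · have hx1 : x ≤ 1 - x₀ := hxκ.le.trans (min_le_right _ _)
    have hin : p₀ x * a ^ (-α) + p₁ x * d ^ (-α) < r := hball ⟨by
      rw [Metric.mem_ball, Real.dist_eq, sub_zero, abs_of_pos hx.1]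
      exact hxκ.trans_le (min_le_left _ _), hx.1.le, hx.2.le⟩
    rw [f0_of_le (by linarith [h.1]), f1_of_le h hx1, Real.mul_rpow ha.le hx.1.le,
      Real.mul_rpow (zero_le_one.trans hb.le) hx.1.le]
    have := mul_le_mul_of_nonneg_right hin.le (Real.rpow_nonneg hx.1.le (-α))
    have : 0 ≤ (a * κ) ^ (-α) := by positivity
    linarith
  · have hle : ∀ z, a * x ≤ z → z ^ (-α) ≤ (a * κ) ^ (-α) := fun z hz =>
      Real.rpow_le_rpow_of_nonpos (by positivity)
        ((mul_le_mul_of_nonneg_left hxκ ha.le).trans hz) (by linarith)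
    have e0 := mul_le_mul_of_nonneg_left (hle _ (slope₀_mul_le_f0 h x)) hp'.2.1
    have e1 := mul_le_mul_of_nonneg_left (hle _ (slope₀_mul_le_f1 h hx)) hp'.2.2
    have e2 : 0 ≤ r * x ^ (-α) := mul_nonneg hr0.le (Real.rpow_nonneg hx.1.le _)
    have e3 : p₀ x * (a * κ) ^ (-α) + p₁ x * (a * κ) ^ (-α) = (a * κ) ^ (-α) := by
      rw [← add_mul, hp'.1, one_mul]
    linarith

theorem exists_lyapunov (h : A1 x₀ y₀) {p₀ p₁ : ℝ → ℝ} (h3 : A3 p₀ p₁) (h4 : A4 x₀ y₀ p₀ p₁) :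
    ∃ V : ℝ → ℝ, ∃ r < 1, ∃ b, 0 ≤ b ∧ (∀ x ∈ Ioo (0 : ℝ) 1, 1 ≤ V x) ∧
      (∀ x ∈ Ioo (0 : ℝ) 1,
        p₀ x * V (f0 x₀ y₀ x) + p₁ x * V (f1 x₀ y₀ x) ≤ r * V x + b) ∧
      ∀ R, ∃ κ, 0 < κ ∧ ∀ x ∈ Ioo (0 : ℝ) 1, x < κ ∨ 1 - κ < x → R ≤ V x := by
  obtain ⟨hp₀, hp₁, hp⟩ := h3
  have ha := h.slope₀_pos
  have hb := zero_lt_one.trans h.one_lt_slope₁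
  have hz := hp 0 (by simp)
  have ho := hp 1 (by simp)
  obtain ⟨α, ⟨hα0, hα1⟩, hα⟩ := (((eventually_average_exp_lt_one hz.1 hz.2.1.le hz.2.2.2.1.le
    h4.1).and (eventually_average_exp_lt_one ho.1 ho.2.1.le ho.2.2.2.1.le h4.2)).and self_mem_nhdsWithin).exists
  have hα : 0 < α := hα
  have hexp : ∀ z : ℝ, 0 < z → Real.exp (-(α * Real.log z)) = z ^ (-α) := by
    intro z hz
    rw [Real.rpow_def_of_pos hz]; ring_nf
  rw [hexp _ ha, hexp _ hb] at hα0 hα1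
  obtain ⟨r, hr, b, hb0, hV⟩ := exists_drift_at_zero h hp₀ hp₁
    (fun x hx => ⟨(hp x hx).1, (hp x hx).2.1.le, (hp x hx).2.2.2.1.le⟩) hα hα0
  have hmaps : MapsTo (fun x : ℝ => 1 - x) (Icc 0 1) (Icc 0 1) := fun x hx =>
    ⟨by linarith [hx.2], by linarith [hx.1]⟩
  have hsub : ContinuousOn (fun x : ℝ => 1 - x) (Icc 0 1) := by fun_prop
  obtain ⟨r', hr', b', hb0', hV'⟩ := exists_drift_at_zero h
    (p₀ := fun x => p₁ (1 - x)) (p₁ := fun x => p₀ (1 - x)) (hp₁.comp hsub hmaps)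
    (hp₀.comp hsub hmaps) (fun x hx => by
      have := hp (1 - x) (hmaps hx)
      exact ⟨(add_comm _ _).trans this.1, this.2.2.2.1.le, this.2.1.le⟩) hα (by simpa [add_comm] using hα1)
  refine ⟨fun x => x ^ (-α) + (1 - x) ^ (-α), max r r', max_lt hr hr', b + b', by positivity,
    fun x hx => ?_, fun x hx => ?_, fun R => ?_⟩
  · have := Real.one_le_rpow_of_pos_of_le_one_of_nonpos hx.1 hx.2.le (neg_nonpos.2 hα.le)
    have := Real.rpow_nonneg (one_sub_mem hx).1.le (-α)
    linarith
  · have e1 := hV x hx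
    have e2 := hV' (1 - x) (one_sub_mem hx)
    rw [f0_one_sub, f1_one_sub, sub_sub_cancel] at e2
    have e3 := mul_le_mul_of_nonneg_right (le_max_left r r') (Real.rpow_nonneg hx.1.le (-α))
    have e4 := mul_le_mul_of_nonneg_right (le_max_right r r')
      (Real.rpow_nonneg (one_sub_mem hx).1.le (-α))
    linarith
  · obtain ⟨κ, hκ, hR⟩ : ∃ κ, 0 < κ ∧ ∀ x, 0 < x → x < κ → R ≤ x ^ (-α) := by
      have := (tendsto_rpow_neg_nhdsGT_zero (y := -α) (by linarith)).eventually_ge_atTop R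
      obtain ⟨κ, hκ, hsub⟩ := mem_nhdsGT_iff_exists_Ioo_subset.1 this
      exact ⟨κ, hκ, fun x h1 h2 => hsub ⟨h1, h2⟩⟩
    refine ⟨κ, hκ, fun x hx hx' => ?_⟩
    have p1 := Real.rpow_nonneg hx.1.le (-α)
    have p2 := Real.rpow_nonneg (one_sub_mem hx).1.le (-α)
    rcases hx' with h1 | h1
    · linarith [hR x hx.1 h1]
    · linarith [hR (1 - x) (one_sub_mem hx).1 (by linarith)]

theorem mem_Icc_of_logDist_le_one {κ x y : ℝ} (hκ : 0 < κ) (hκ' : κ ≤ 1 / 2) (hx : κ ≤ x)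
    (hx' : x ≤ 1 - κ) (hy : y ∈ Ioo (0 : ℝ) 1) (hxy : |logCoord x - logCoord y| ≤ 1) :
    y ∈ Icc (κ * Real.exp (-1)) (1 - κ * Real.exp (-1)) := by
  have lower : ∀ x y, κ ≤ x → x ≤ 1 - κ → y ∈ Ioo (0 : ℝ) 1 → logCoord x - logCoord y ≤ 1 →
      κ * Real.exp (-1) ≤ y := by
    intro x y hx hx' hy hxy
    by_contra! hlt
    have he : Real.exp (-1) < 1 := by simp
    have hk : κ * Real.exp (-1) < 1 / 2 := by nlinarith
    have h1 := logCoord_lt hy.1 hlt (by linarith)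
    have h2 := logCoord_le hκ hx (by linarith)
    rw [logCoord_of_le hk.le, ← mul_assoc, Real.log_mul (by positivity) (by positivity),
      Real.log_exp] at h1
    rw [logCoord_of_le hκ'] at h2
    linarith
  refine ⟨lower x y hx hx' hy (le_of_abs_le hxy), ?_⟩
  have := lower (1 - x) (1 - y) (by linarith) (by linarith) (one_sub_mem hy) (by
    rw [logCoord_one_sub, logCoord_one_sub]; linarith [neg_le_of_abs_le hxy])
  linarith

theorem logDist_le_div {κ x y : ℝ} (hκ : 0 < κ) (hx : x ∈ Icc κ (1 - κ))
    (hy : y ∈ Icc κ (1 - κ)) : |logCoord x - logCoord y| ≤ |x - y| / κ := by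
  wlog hxy : x ≤ y generalizing x y
  · rw [abs_sub_comm, abs_sub_comm x]; exact this hy hx (le_of_not_ge hxy)
  have := logCoord_sub_le hκ hx.1 hxy hy.2
  have := logCoord_le (hκ.trans_le hx.1) hxy (by linarith [hy.2])
  rw [abs_sub_comm, abs_sub_comm x, abs_of_nonneg (by linarith), abs_of_nonneg (by linarith)]
  assumption

theorem A3.exists_lower_bound {p₀ p₁ : ℝ → ℝ} (h3 : A3 p₀ p₁) :
    ∃ c, 0 < c ∧ c ≤ 1 / 2 ∧ ∀ x ∈ Icc (0 : ℝ) 1, c ≤ p₀ x ∧ c ≤ p₁ x := by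
  obtain ⟨hp₀, hp₁, hp⟩ := h3
  obtain ⟨z, hz, hmin⟩ := isCompact_Icc.exists_isMinOn (nonempty_Icc.2 zero_le_one)
    (hp₀.inf hp₁)
  have hle : ∀ x ∈ Icc (0 : ℝ) 1, min (p₀ z) (p₁ z) ≤ min (p₀ x) (p₁ x) := fun x hx => hmin hx
  refine ⟨min (p₀ z) (p₁ z), lt_min (hp z hz).2.1 (hp z hz).2.2.2.1, ?_,
    fun x hx => le_min_iff.1 (hle x hx)⟩
  linarith [min_le_left (p₀ z) (p₁ z), min_le_right (p₀ z) (p₁ z), (hp z hz).1]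

/-- There is a distance-like function on nearby pairs which dominates the Euclidean distance and
is strictly contracted on average by one step of the system. -/
theorem exists_average_contraction (h : A1 x₀ y₀) {p₀ p₁ : ℝ → ℝ} (h3 : A3 p₀ p₁)
    (h4 : A4 x₀ y₀ p₀ p₁) :
    ∃ G : ℝ → ℝ → ℝ, ∃ θ, 0 < θ ∧ θ < 1 ∧
      (∀ x ∈ Ioo (0 : ℝ) 1, ∀ y ∈ Ioo (0 : ℝ) 1, |x - y| ≤ G x y) ∧
      (∀ x ∈ Ioo (0 : ℝ) 1, ∀ y ∈ Ioo (0 : ℝ) 1, |logCoord x - logCoord y| ≤ 1 →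
        p₀ x * G (f0 x₀ y₀ x) (f0 x₀ y₀ y) + p₁ x * G (f1 x₀ y₀ x) (f1 x₀ y₀ y) ≤ θ * G x y) ∧
      ∀ x ∈ Ioo (0 : ℝ) 1, ∃ M, 0 ≤ M ∧ ∀ y ∈ Ioo (0 : ℝ) 1,
        G x y ≤ M * |logCoord x - logCoord y| := by
  obtain ⟨c, hc, hc', hpc⟩ := h3.exists_lower_bound
  obtain ⟨V, r, hr, b, hb, hV1, hVdrift, hVlarge⟩ := exists_lyapunov h h3 h4
  obtain ⟨κ₀, hκ₀, hlarge⟩ := hVlarge (2 * b / (1 - r))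
  set κ := min κ₀ (1 / 2) with hκdef
  have hκ : 0 < κ := lt_min hκ₀ (by norm_num)
  have hκ2 : κ ≤ 1 / 2 := min_le_right _ _
  set κ' := κ * Real.exp (-1) with hκ'def
  have hκ' : 0 < κ' := by positivity
  have hκκ' : κ' ≤ κ := mul_le_of_le_one_right hκ.le (by simp)
  obtain ⟨m, ε₀, hε₀, hm, hgain⟩ := exists_gain_sub_ge h hc hc' hκ'
  have hgain' : ∀ x ∈ Icc κ (1 - κ), ∀ y ∈ Ioo (0 : ℝ) 1, |logCoord x - logCoord y| ≤ 1 →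
      ε₀ * κ' * |logCoord x - logCoord y| ≤ |gain x₀ y₀ c m x - gain x₀ y₀ c m y| := by
    intro x hx y hy hxy
    have hy' := mem_Icc_of_logDist_le_one hκ hκ2 hx.1 hx.2 hy hxy
    have hx' : x ∈ Icc κ' (1 - κ') := ⟨hκκ'.trans hx.1, by linarith [hx.2]⟩
    have h1 := (le_div_iff₀ hκ').1 (logDist_le_div hκ' hx' hy')
    have h2 : ε₀ * |x - y| ≤ |gain x₀ y₀ c m x - gain x₀ y₀ c m y| := by
      rcases le_total x y with hle | hle
      · rw [abs_sub_comm, abs_sub_comm (gain x₀ y₀ c m x), abs_of_nonneg (sub_nonneg.2 hle)]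
        exact (hgain x y hx'.1 hle hy'.2).trans (le_abs_self _)
      · rw [abs_of_nonneg (sub_nonneg.2 hle)]
        exact (hgain y x hy'.1 hle hx'.2).trans (le_abs_self _)
    have h3 := mul_le_mul_of_nonneg_left h1 hε₀.le
    linarith
  set ε := ε₀ * κ' with hεdef
  have hε : 0 < ε := by positivity
  set δ := ε / (2 * (b + 1)) with hδdef
  have hδ : 0 < δ := by positivity
  have hδb : δ * b ≤ ε / 2 := by
    rw [hδdef, div_mul_eq_mul_div, div_le_iff₀ (by positivity)]
    nlinarith
  have hm0 : (0 : ℝ) < m := by exact_mod_cast hm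
  have h1r : 0 < 1 - r := by linarith
  obtain ⟨τ, hτ, hτ1, hτ2, hτ3, hτ4⟩ : ∃ τ, 0 < τ ∧ τ ≤ 1 / 2 ∧ τ * m ≤ ε / 2 ∧
      τ ≤ (1 - r) / 4 ∧ τ * m ≤ δ * (1 - r) / 4 := by
    refine ⟨min (min (1 / 2) ((1 - r) / 4)) (min (ε / 2 / m) (δ * (1 - r) / 4 / m)),
      by positivity, (min_le_left _ _).trans (min_le_left _ _),
      (le_div_iff₀ hm0).1 ((min_le_right _ _).trans (min_le_left _ _)),
      (min_le_left _ _).trans (min_le_right _ _),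
      (le_div_iff₀ hm0).1 ((min_le_right _ _).trans (min_le_right _ _))⟩
  set S : ℝ → ℝ → ℝ := fun x y => ∑ j ∈ Finset.range m, reducedDist x₀ y₀ c j x y with hSdef
  have hS1 : ∀ x ∈ Ioo (0 : ℝ) 1, ∀ y ∈ Ioo (0 : ℝ) 1, |logCoord x - logCoord y| ≤ S x y := by
    intro x hx y hy
    rw [← reducedDist_zero (x₀ := x₀) (y₀ := y₀) c]
    exact Finset.single_le_sum (f := fun j => reducedDist x₀ y₀ c j x y)
      (fun j _ => reducedDist_nonneg h hc.le hc' j hx hy) (Finset.mem_range.2 hm)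
  have hS2 : ∀ x y, S x y ≤ m * |logCoord x - logCoord y| := by
    intro x y
    calc S x y ≤ ∑ j ∈ Finset.range m, |logCoord x - logCoord y| :=
          Finset.sum_le_sum fun j _ => reducedDist_le c j x y
      _ = _ := by simp
  have hS3 : ∀ x ∈ Ioo (0 : ℝ) 1, ∀ y ∈ Ioo (0 : ℝ) 1,
      p₀ x * S (f0 x₀ y₀ x) (f0 x₀ y₀ y) + p₁ x * S (f1 x₀ y₀ x) (f1 x₀ y₀ y) ≤
        S x y - |gain x₀ y₀ c m x - gain x₀ y₀ c m y| := by
    intro x hx y hy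
    have hx' : x ∈ Icc (0 : ℝ) 1 := Ioo_subset_Icc_self hx
    simp only [hSdef]
    rw [Finset.mul_sum, Finset.mul_sum, ← Finset.sum_add_distrib]
    have h1 := Finset.sum_le_sum (s := Finset.range m) fun j _ =>
      average_reducedDist_le h hc.le (hpc x hx').1 (hpc x hx').2 (h3.2.2 x hx').1 j hx hy
    have h2 := Finset.sum_range_succ' (fun j => reducedDist x₀ y₀ c j x y) m
    rw [Finset.sum_range_succ, reducedDist_zero] at h2
    have h3 : reducedDist x₀ y₀ c m x y =
      |logCoord x - logCoord y| - |gain x₀ y₀ c m x - gain x₀ y₀ c m y| := rfl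
    linarith
  refine ⟨fun x y => S x y + δ * V x * |logCoord x - logCoord y|, 1 - τ, by linarith, by linarith,
    fun x hx y hy => ?_, fun x hx y hy hxy => ?_, fun x hx => ?_⟩
  · have h1 := abs_sub_le_logDist hx hy
    have h2 := hS1 x hx y hy
    have h3 : 0 ≤ δ * V x * |logCoord x - logCoord y| :=
      mul_nonneg (mul_nonneg hδ.le (zero_le_one.trans (hV1 x hx))) (abs_nonneg _)
    linarith
  · have hp := h3.2.2 x (Ioo_subset_Icc_self hx)
    have d0 := logDist_f0_le h hx hy
    have d1 := logDist_f1_le h hx hy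
    have hs := hS3 x hx y hy
    have hs2 := hS2 x y
    have hL := abs_nonneg (gain x₀ y₀ c m x - gain x₀ y₀ c m y)
    have hK := hgain' x
    have hd0 := abs_nonneg (logCoord x - logCoord y)
    have v0 := zero_le_one.trans (hV1 _ (f0_mem h hx))
    have v1 := zero_le_one.trans (hV1 _ (f1_mem h hx))
    have e0 := mul_le_mul_of_nonneg_left d0 (mul_nonneg hp.2.1.le (mul_nonneg hδ.le v0))
    have e1 := mul_le_mul_of_nonneg_left d1 (mul_nonneg hp.2.2.2.1.le (mul_nonneg hδ.le v1))
    have hv := hV1 x hx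
    have hdrift := mul_le_mul_of_nonneg_right (mul_le_mul_of_nonneg_left (hVdrift x hx) hδ.le) hd0
    have hbound : τ * S x y + τ * (δ * V x * |logCoord x - logCoord y|) ≤
        |gain x₀ y₀ c m x - gain x₀ y₀ c m y| +
          δ * ((1 - r) * V x - b) * |logCoord x - logCoord y| := by
      set d := |logCoord x - logCoord y|
      have hδVd : 0 ≤ δ * V x * d := by positivity
      have t1 := mul_le_mul_of_nonneg_left hs2 hτ.le
      have t4 := mul_le_mul_of_nonneg_right hτ3 hδVd
      by_cases hxK : x ∈ Icc κ (1 - κ)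
      · have t2 := hK hxK y hy hxy
        have t3 := mul_le_mul_of_nonneg_right hτ2 hd0
        have t5 := mul_le_mul_of_nonneg_right hδb hd0
        have t6 := mul_nonneg h1r.le hδVd
        linarith
      · have hout : x < κ₀ ∨ 1 - κ₀ < x := by
          by_contra! hcon
          exact hxK ⟨(min_le_left _ _).trans hcon.1,
            by linarith [min_le_left κ₀ (1 / 2)]⟩
        have t2 := (div_le_iff₀ h1r).1 (hlarge x hx hout)
        have t3 := mul_le_mul_of_nonneg_right hτ4 hd0
        have t5 := mul_le_mul_of_nonneg_left t2 (mul_nonneg hδ.le hd0)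
        have t6 := mul_le_mul_of_nonneg_left hv (mul_nonneg (mul_nonneg hδ.le h1r.le) hd0)
        linarith
    linarith
  · refine ⟨m + δ * V x, add_nonneg hm0.le (mul_nonneg hδ.le (zero_le_one.trans (hV1 x hx))),
      fun y _ => ?_⟩
    have := hS2 x y
    linarith

theorem abs_iterate_U_le (h : A1 x₀ y₀) {p₀ p₁ : ℝ → ℝ} (h3 : A3 p₀ p₁) {φ : ℝ → ℝ} {K : ℝ}
    (hφ : ∀ t ∈ Ioo (0 : ℝ) 1, |φ t| ≤ K) (n : ℕ) {x : ℝ} (hx : x ∈ Ioo (0 : ℝ) 1) :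
    |((U x₀ y₀ p₀ p₁)^[n] φ) x| ≤ K := by
  induction n generalizing x with
  | zero => exact hφ x hx
  | succ n ih =>
    rw [Function.iterate_succ_apply']
    have hp := h3.2.2 x (Ioo_subset_Icc_self hx)
    have h0 := abs_le.1 (ih (f0_mem h hx))
    have h1 := abs_le.1 (ih (f1_mem h hx))
    have hK : p₀ x * K + p₁ x * K = K := by rw [← add_mul, hp.1, one_mul]
    rw [U, abs_le]
    constructor
    · linarith [mul_le_mul_of_nonneg_left h0.1 hp.2.1.le,
        mul_le_mul_of_nonneg_left h1.1 hp.2.2.2.1.le]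
    · linarith [mul_le_mul_of_nonneg_left h0.2 hp.2.1.le,
        mul_le_mul_of_nonneg_left h1.2 hp.2.2.2.1.le]

theorem abs_iterate_U_sub_le (h : A1 x₀ y₀) {p₀ p₁ β φ : ℝ → ℝ} (h3 : A3 p₀ p₁)
    (hβ : ∀ t : ℝ, ∀ x ∈ Icc (0 : ℝ) 1, ∀ y ∈ Icc (0 : ℝ) 1, |x - y| ≤ t →
      |p₀ x - p₀ y| ≤ β t ∧ |p₁ x - p₁ y| ≤ β t)
    {G : ℝ → ℝ → ℝ} {θ η K L C : ℝ} (hη : 0 < η) (hη1 : η < 1)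
    (hG : ∀ x ∈ Ioo (0 : ℝ) 1, ∀ y ∈ Ioo (0 : ℝ) 1, |x - y| ≤ G x y)
    (hGθ : ∀ x ∈ Ioo (0 : ℝ) 1, ∀ y ∈ Ioo (0 : ℝ) 1, |logCoord x - logCoord y| ≤ 1 →
      p₀ x * G (f0 x₀ y₀ x) (f0 x₀ y₀ y) + p₁ x * G (f1 x₀ y₀ x) (f1 x₀ y₀ y) ≤ θ * G x y)
    (hφ : ∀ t ∈ Ioo (0 : ℝ) 1, |φ t| ≤ K)
    (hL : ∀ u ∈ Ioo (0 : ℝ) 1, ∀ v ∈ Ioo (0 : ℝ) 1, |φ u - φ v| ≤ L * |u - v|)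
    (hC0 : 0 ≤ C) (hLC : L ≤ C) (hC : C * (η⁻¹ * θ) + 2 * K ≤ C) (n N : ℕ) {x y : ℝ}
    (hx : x ∈ Ioo (0 : ℝ) 1) (hy : y ∈ Ioo (0 : ℝ) 1) (hxy : |logCoord x - logCoord y| ≤ 1) :
    |((U x₀ y₀ p₀ p₁)^[n] φ) x - ((U x₀ y₀ p₀ p₁)^[n] φ) y| ≤
      2 * K * ∑ j ∈ Finset.range n, β (η ^ (N + j)) + C * η⁻¹ ^ N * G x y := by
  have hK : 0 ≤ K := (abs_nonneg _).trans (hφ x hx)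
  induction n generalizing N x y with
  | zero =>
    have hw : 1 ≤ η⁻¹ ^ N := one_le_pow₀ (one_le_inv₀ hη |>.2 hη1.le)
    have h1 := hL x hx y hy
    have h2 := mul_le_mul_of_nonneg_right hLC (abs_nonneg (x - y))
    have h3 := mul_le_mul_of_nonneg_left (hG x hx y hy) (mul_nonneg hC0 (zero_le_one.trans hw))
    have h4 := mul_le_mul_of_nonneg_left hw (mul_nonneg hC0 (abs_nonneg (x - y)))
    simp only [Function.iterate_zero, id, Finset.range_zero, Finset.sum_empty, mul_zero, zero_add]
    linarith
  | succ n ih =>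
    simp only [Function.iterate_succ_apply']
    have hx' : x ∈ Icc (0 : ℝ) 1 := Ioo_subset_Icc_self hx
    have hy' : y ∈ Icc (0 : ℝ) 1 := Ioo_subset_Icc_self hy
    have hp := h3.2.2 x hx'
    have hpy := h3.2.2 y hy'
    have i0 := ih (N + 1) (f0_mem h hx) (f0_mem h hy) ((logDist_f0_le h hx hy).trans hxy)
    have i1 := ih (N + 1) (f1_mem h hx) (f1_mem h hy) ((logDist_f1_le h hx hy).trans hxy)
    have b0 := abs_iterate_U_le h h3 hφ n (f0_mem h hy)
    have b1 := abs_iterate_U_le h h3 hφ n (f1_mem h hy)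
    set u := (U x₀ y₀ p₀ p₁)^[n] φ
    set w := η⁻¹ ^ N with hwdef
    have hw : 0 < w := by positivity
    have hβ0 : 0 ≤ β (η ^ N) :=
      (abs_nonneg _).trans (hβ (η ^ N) x hx' x hx' (by simpa using by positivity)).1
    have hG0 : 0 ≤ G x y := (abs_nonneg _).trans (hG x hx y hy)
    have hpdiff : |p₀ x - p₀ y| ≤ β (η ^ N) + w * G x y ∧
        |p₁ x - p₁ y| ≤ β (η ^ N) + w * G x y := by
      rcases le_or_gt |x - y| (η ^ N) with hle | hlt
      · obtain ⟨e0, e1⟩ := hβ _ x hx' y hy' hle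
        have := mul_nonneg hw.le hG0
        exact ⟨by linarith, by linarith⟩
      · have h1 : 1 ≤ w * G x y := by
          have : w * η ^ N = 1 := by
            rw [hwdef, ← mul_pow, inv_mul_cancel₀ hη.ne', one_pow]
          rw [← this]
          exact mul_le_mul_of_nonneg_left (hlt.le.trans (hG x hx y hy)) hw.le
        constructor <;> rw [abs_le] <;> constructor <;> linarith
    have hsplit : U x₀ y₀ p₀ p₁ u x - U x₀ y₀ p₀ p₁ u y =
        p₀ x * (u (f0 x₀ y₀ x) - u (f0 x₀ y₀ y)) + p₁ x * (u (f1 x₀ y₀ x) - u (f1 x₀ y₀ y)) +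
        ((p₀ x - p₀ y) * u (f0 x₀ y₀ y) + (p₁ x - p₁ y) * u (f1 x₀ y₀ y)) := by
      simp only [U]; ring
    have m0 := mul_le_mul_of_nonneg_left i0 hp.2.1.le
    have m1 := mul_le_mul_of_nonneg_left i1 hp.2.2.2.1.le
    have m2 := mul_le_mul hpdiff.1 b0 (abs_nonneg _) ((abs_nonneg _).trans hpdiff.1)
    have m3 := mul_le_mul hpdiff.2 b1 (abs_nonneg _) ((abs_nonneg _).trans hpdiff.2)
    have hsum : ∑ j ∈ Finset.range (n + 1), β (η ^ (N + j)) =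
        ∑ j ∈ Finset.range n, β (η ^ (N + 1 + j)) + β (η ^ N) := by
      rw [Finset.sum_range_succ']
      simp only [add_zero]
      congr 1
      exact Finset.sum_congr rfl fun j _ => by rw [add_right_comm, add_assoc]
    have tri : |U x₀ y₀ p₀ p₁ u x - U x₀ y₀ p₀ p₁ u y| ≤
        p₀ x * |u (f0 x₀ y₀ x) - u (f0 x₀ y₀ y)| + p₁ x * |u (f1 x₀ y₀ x) - u (f1 x₀ y₀ y)| +
        (|p₀ x - p₀ y| * |u (f0 x₀ y₀ y)| + |p₁ x - p₁ y| * |u (f1 x₀ y₀ y)|) := by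
      rw [hsplit]
      refine (abs_add_le _ _).trans (add_le_add ((abs_add_le _ _).trans_eq ?_)
        ((abs_add_le _ _).trans_eq ?_))
      · rw [abs_mul, abs_mul, abs_of_pos hp.2.1, abs_of_pos hp.2.2.2.1]
      · rw [abs_mul, abs_mul]
    rw [hsum]
    have hcontr := mul_le_mul_of_nonneg_left (hGθ x hx y hy hxy)
      (mul_nonneg hC0 (mul_nonneg hw.le (inv_nonneg.2 hη.le)))
    have hfin := mul_le_mul_of_nonneg_right hC (mul_nonneg hw.le hG0)
    rw [pow_succ, ← hwdef] at m0 m1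
    set s := ∑ j ∈ Finset.range n, β (η ^ (N + 1 + j))
    have hpp : p₀ x * (2 * K * s) + p₁ x * (2 * K * s) = 2 * K * s := by
      rw [← add_mul, hp.1, one_mul]
    linarith

end AM

/-- for every bounded Lipschitz `φ : (0,1) → ℝ`, the family `(Uⁿφ)` is
equicontinuous at every point of `[1−x₀, x₀]`. -/
theorem stmt18 (x₀ y₀ : ℝ) (p₀ p₁ : ℝ → ℝ)
    (hA1 : AM.A1 x₀ y₀) (hA2 : AM.A2 p₀ p₁) (hA3 : AM.A3 p₀ p₁) (hA4 : AM.A4 x₀ y₀ p₀ p₁)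
    (φ : ℝ → ℝ)
    (hφb : ∃ K : ℝ, ∀ t ∈ Set.Ioo (0:ℝ) 1, |φ t| ≤ K)
    (hφl : ∃ Lf : ℝ, 0 ≤ Lf ∧
      ∀ u ∈ Set.Ioo (0:ℝ) 1, ∀ v ∈ Set.Ioo (0:ℝ) 1, |φ u - φ v| ≤ Lf * |u - v|) :
    ∀ x ∈ Set.Icc (1 - x₀) x₀, ∀ δ : ℝ, 0 < δ →
      ∃ d : ℝ, 0 < d ∧
        ∀ n : ℕ, ∀ y ∈ Set.Ioo (0:ℝ) 1, |x - y| < d →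
          |((AM.U x₀ y₀ p₀ p₁)^[n] φ) x - ((AM.U x₀ y₀ p₀ p₁)^[n] φ) y| < δ := by
  obtain ⟨K, hK⟩ := hφb
  obtain ⟨L, hL0, hL⟩ := hφl
  obtain ⟨β, hβ, hsum⟩ := hA2
  obtain ⟨G, θ, hθ0, hθ1, hG, hGθ, hGM⟩ := AM.exists_average_contraction hA1 hA3 hA4
  intro x hx δ hδ
  have hx01 : x ∈ Set.Ioo (0 : ℝ) 1 := ⟨by linarith [hx.1, hA1.2.1], by linarith [hx.2, hA1.2.1]⟩
  have hK0 : 0 ≤ K := (abs_nonneg _).trans (hK x hx01)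
  obtain ⟨η, hθη, hη1⟩ := exists_between hθ1
  have hη : 0 < η := hθ0.trans hθη
  have hq : η⁻¹ * θ < 1 := by rwa [inv_mul_lt_iff₀ hη, mul_one]
  obtain ⟨C, hC0, hLC, hC⟩ : ∃ C, 0 ≤ C ∧ L ≤ C ∧ C * (η⁻¹ * θ) + 2 * K ≤ C := by
    have hq' : 0 < 1 - η⁻¹ * θ := by linarith
    refine ⟨L + 2 * K / (1 - η⁻¹ * θ), by positivity, le_add_of_nonneg_right (by positivity), ?_⟩
    have h1 : 2 * K / (1 - η⁻¹ * θ) * (1 - η⁻¹ * θ) = 2 * K := div_mul_cancel₀ _ hq'.ne'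
    have h2 := mul_nonneg hL0 hq'.le
    linarith
  have hsummable : Summable fun n : ℕ => β (η ^ n) := by
    simpa using hsum 1 zero_le_one η hη hη1
  have hβ0 : ∀ n : ℕ, 0 ≤ β (η ^ n) := fun n =>
    (abs_nonneg _).trans (hβ (η ^ n) 0 (by simp) 0 (by simp) (by simpa using by positivity)).1
  obtain ⟨N, hN⟩ : ∃ N : ℕ, 2 * K * ∑' j, β (η ^ (j + N)) < δ / 2 := by
    have := (tendsto_sum_nat_add fun n => β (η ^ n)).const_mul (2 * K)
    rw [mul_zero] at this
    exact (this.eventually_lt_const (half_pos hδ)).exists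
  have htail : ∀ n, ∑ j ∈ Finset.range n, β (η ^ (N + j)) ≤ ∑' j, β (η ^ (j + N)) := fun n => by
    simp only [add_comm N]
    exact ((summable_nat_add_iff N).2 hsummable).sum_le_tsum _ fun j _ => hβ0 _
  obtain ⟨M, hM0, hM⟩ := hGM x hx01
  set A := C * η⁻¹ ^ N * M with hAdef
  have hA : 0 ≤ A := by positivity
  obtain ⟨κ, hκ, hκx, hκx'⟩ : ∃ κ, 0 < κ ∧ 2 * κ ≤ x ∧ x ≤ 1 - 2 * κ := by
    refine ⟨min x (1 - x) / 2, half_pos (lt_min hx01.1 (by linarith [hx01.2])), ?_, ?_⟩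
    · linarith [min_le_left x (1 - x)]
    · linarith [min_le_right x (1 - x)]
  refine ⟨min κ (κ * (δ / 2 / (A + 1))), by positivity, fun n y hy hxy => ?_⟩
  have hxyκ := hxy.trans_le (min_le_left _ _)
  have hdist := AM.logDist_le_div (y := y) hκ (x := x) ⟨by linarith, by linarith⟩
    ⟨by linarith [(abs_lt.1 hxyκ).2], by linarith [(abs_lt.1 hxyκ).1]⟩
  have hone : |AM.logCoord x - AM.logCoord y| ≤ 1 :=
    hdist.trans ((div_le_one hκ).2 hxyκ.le)
  have hsmall : |AM.logCoord x - AM.logCoord y| ≤ δ / 2 / (A + 1) :=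
    hdist.trans ((div_le_iff₀' hκ).2 (hxy.trans_le (min_le_right _ _)).le)
  have hAδ : A * |AM.logCoord x - AM.logCoord y| ≤ δ / 2 := by
    have := (le_div_iff₀ (by positivity)).1 hsmall
    linarith [abs_nonneg (AM.logCoord x - AM.logCoord y)]
  have hmain := AM.abs_iterate_U_sub_le hA1 hA3 hβ hη hη1 hG hGθ hK hL hC0 hLC hC n N hx01 hy hone
  have h1 := mul_le_mul_of_nonneg_left (htail n) (mul_nonneg zero_le_two hK0)
  have h2 := mul_le_mul_of_nonneg_left (hM y hy) (show 0 ≤ C * η⁻¹ ^ N by positivity)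
  rw [← mul_assoc, ← hAdef] at h2
  linarith
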